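/- (Links Lemma.) Let R be a commutative ring, Δ a finite abstract simplicial complex, and F an ℓ-dimensional face of Δ. If Δ is resolution j-chordal over R for every j with k−ℓ−1 ≤ j ≤ k, then the link Lk_F Δ is resolution (k−ℓ−1)-chordal over R. -/

import Mathlib

/-!
Basic notions for homological chordality of simplicial complexes,
following Adiprasito–Nevo–Samper, "Higher chordality: From graphs to complexes".

A finite abstract simplicial complex is modelled as a downward-closed finite
family of finite subsets of a vertex type `V`.  Chains of dimension `k` (with
coefficients in a commutative ring `R`) are functions `Finset V → R` supported
on faces of cardinality `k + 1`; the simplicial boundary operator includes the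
augmentation (so `0`-cycles are *reduced* cycles), matching the paper's
convention that `C₋₁` is generated by the empty face.
-/

open Finset

attribute [local instance] Classical.propDecidable

noncomputable section

/-- A finite abstract simplicial complex with vertices in `V`:
a downward-closed finite family of finite subsets of `V`. -/
structure ASC (V : Type*) where
  faces : Finset (Finset V)
  down_closed : ∀ ⦃s t : Finset V⦄, s ∈ faces → t ⊆ s → t ∈ faces

variable {V : Type*} [Fintype V] [LinearOrder V]

/-- `(-1)` to the number of elements of `t` smaller than `v`; this is the sign
of the position of `v` in the ordered set `insert v t`. -/
def esign (v : V) (t : Finset V) : ℤ :=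
  (-1) ^ (t.filter fun w => w < v).card

/-- The simplicial boundary operator (including the augmentation at the empty
face): `(bdry c) t = ∑_{v ∉ t} ± c (insert v t)`. -/
def bdry {R : Type*} [CommRing R] (c : Finset V → R) : Finset V → R :=
  fun t => ∑ v ∈ tᶜ, esign v t • c (insert v t)

/-- `c` is a chain of dimension `k` on the set of faces `S`:
it is supported on members of `S` of cardinality `k + 1`. -/
def IsChainOn {R : Type*} [CommRing R] (S : Set (Finset V)) (k : ℤ)
    (c : Finset V → R) : Prop :=
  ∀ s : Finset V, c s ≠ 0 → s ∈ S ∧ (s.card : ℤ) = k + 1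

/-- The vertex support `c⁰` of a chain: all vertices lying in a face with a
nonzero coefficient. -/
def vsupp {R : Type*} [CommRing R] (c : Finset V → R) : Set V :=
  {v | ∃ s : Finset V, c s ≠ 0 ∧ v ∈ s}

/-- Vanishing of the `k`-th (reduced) homology of the family of faces `S` over `R`:
every `k`-cycle is the boundary of a `(k+1)`-chain. -/
def HVanish (R : Type*) [CommRing R] (S : Set (Finset V)) (k : ℤ) : Prop :=
  ∀ z : Finset V → R, IsChainOn S k z → bdry z = 0 →
    ∃ c : Finset V → R, IsChainOn S (k + 1) c ∧ bdry c = z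

/-- `Δ` is resolution `k`-chordal over `R`: every `k`-cycle `z` of `Δ` admits a
resolution, i.e. a `(k+1)`-chain `c` of `Δ` with `∂c = z` and the same vertex
support as `z`. -/
def ResChordal (R : Type*) [CommRing R] (Δ : ASC V) (k : ℤ) : Prop :=
  ∀ z : Finset V → R, IsChainOn (↑Δ.faces) k z → bdry z = 0 →
    ∃ c : Finset V → R, IsChainOn (↑Δ.faces) (k + 1) c ∧ bdry c = z ∧ vsupp c = vsupp z

/-- `z` is a complete `k`-cycle on the face set `S`: it is a `k`-cycle whose
faces with nonzero coefficient are precisely all the `k`-dimensional faces of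
some set `W` of `k + 2` vertices, and all those faces belong to `S`. -/
def IsCompleteCycleOn {R : Type*} [CommRing R] (S : Set (Finset V)) (k : ℤ)
    (z : Finset V → R) : Prop :=
  bdry z = 0 ∧ ∃ W : Finset V, (W.card : ℤ) = k + 2 ∧
    (∀ s : Finset V, z s ≠ 0 ↔ s ⊆ W ∧ (s.card : ℤ) = k + 1) ∧
    ∀ s : Finset V, s ⊆ W → (s.card : ℤ) = k + 1 → s ∈ S

/-- `Δ` is decomposition `k`-chordal over `R`: every `k`-cycle `z` of `Δ` is a
sum of complete `k`-cycles of `Δ` supporting only vertices supported in `z`. -/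
def DecChordal (R : Type*) [CommRing R] (Δ : ASC V) (k : ℤ) : Prop :=
  ∀ z : Finset V → R, IsChainOn (↑Δ.faces) k z → bdry z = 0 →
    ∃ (n : ℕ) (zs : Fin n → Finset V → R),
      z = ∑ i, zs i ∧
      ∀ i, IsCompleteCycleOn (↑Δ.faces) k (zs i) ∧ vsupp (zs i) ⊆ vsupp z

/-- `σ` is a missing face (minimal nonface) of `Δ`: `σ` is not a face but all
its proper subsets are.  Its dimension is `σ.card - 1`. -/
def IsMissingFace (Δ : ASC V) (σ : Finset V) : Prop :=
  σ ∉ Δ.faces ∧ ∀ t ⊂ σ, t ∈ Δ.faces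

/-- The induced subcomplex `Δ|W` on a subset `W` of the vertices. -/
def induced (Δ : ASC V) (W : Finset V) : ASC V where
  faces := Δ.faces.filter fun s => s ⊆ W
  down_closed := by
    intro s t hs hts
    simp only [mem_filter] at hs ⊢
    exact ⟨Δ.down_closed hs.1 hts, hts.trans hs.2⟩

/-- `Δ` is `k`-Leray over `R`: the reduced homology `H̃ⱼ(Δ|W; R)` vanishes for
every `j ≥ k` and every vertex subset `W`. -/
def IsLeray (R : Type*) [CommRing R] (Δ : ASC V) (k : ℤ) : Prop :=
  ∀ (W : Finset V) (j : ℤ), k ≤ j → HVanish R (((induced Δ W).faces : Set (Finset V))) j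

/-- The closed star `St_σ Δ = ∪_{σ ⊆ τ ∈ Δ} 2^τ`. -/
def star (Δ : ASC V) (σ : Finset V) : ASC V where
  faces := Δ.faces.filter fun s => ∃ τ ∈ Δ.faces, σ ⊆ τ ∧ s ⊆ τ
  down_closed := by
    intro s t hs hts
    simp only [mem_filter] at hs ⊢
    obtain ⟨h1, τ', h2, h3, h4⟩ := hs
    exact ⟨Δ.down_closed h1 hts, τ', h2, h3, hts.trans h4⟩

/-- The deletion `Δ - σ`: the maximal subcomplex of `Δ` not containing `σ`. -/
def del (Δ : ASC V) (σ : Finset V) : ASC V where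
  faces := Δ.faces.filter fun s => ¬ σ ⊆ s
  down_closed := by
    intro s t hs hts
    simp only [mem_filter] at hs ⊢
    exact ⟨Δ.down_closed hs.1 hts, fun h => hs.2 (h.trans hts)⟩

/-- The extended link `eLk_σ Δ = St_σ Δ - σ`. -/
def eLk (Δ : ASC V) (σ : Finset V) : ASC V := del (star Δ σ) σ

/-- The link `Lk_σ Δ = {τ \ σ : σ ⊆ τ ∈ Δ}`. -/
def link (Δ : ASC V) (σ : Finset V) : ASC V where
  faces := Finset.univ.filter fun t => Disjoint σ t ∧ σ ∪ t ∈ Δ.faces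
  down_closed := by
    intro s t hs hts
    simp only [mem_filter, mem_univ, true_and] at hs ⊢
    exact ⟨hs.1.mono_right hts, Δ.down_closed hs.2 (union_subset_union_right hts)⟩

/-- The `k`-clique complex `Cl_k Δ`: faces are the sets of vertices of `Δ` all
of whose subsets of cardinality at most `k + 1` are faces of `Δ`. -/
def clique (Δ : ASC V) (k : ℤ) : ASC V where
  faces := Finset.univ.filter fun s =>
    (∀ v ∈ s, {v} ∈ Δ.faces) ∧ ∀ t ⊆ s, (t.card : ℤ) ≤ k + 1 → t ∈ Δ.faces
  down_closed := by
    intro s t hs hts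
    simp only [mem_filter, mem_univ, true_and] at hs ⊢
    exact ⟨fun v hv => hs.1 v (hts hv), fun u hu hc => hs.2 u (hu.trans hts) hc⟩

/-- The vertex set of a complex, as a set of elements of `V`. -/
def vertexSet (Δ : ASC V) : Set V := {v | {v} ∈ Δ.faces}

/-- The relative simplicial complex `(Δ, Γ)` is resolution `k`-chordal over `R`:
every relative `k`-cycle (a `k`-chain of `Δ` supported off `Γ` whose boundary
is a chain of `Γ`) admits a resolution, i.e. a `(k+1)`-chain `c` of `Δ`
supported off `Γ` with `∂c ≡ z` modulo chains of `Γ` and `vsupp c = vsupp z`. -/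
def RelResChordal (R : Type*) [CommRing R] (Δ Γ : ASC V) (k : ℤ) : Prop :=
  ∀ z : Finset V → R, IsChainOn (↑Δ.faces) k z → (∀ s, z s ≠ 0 → s ∉ Γ.faces) →
    IsChainOn (↑Γ.faces) (k - 1) (bdry z) →
    ∃ c : Finset V → R, IsChainOn (↑Δ.faces) (k + 1) c ∧ (∀ s, c s ≠ 0 → s ∉ Γ.faces) ∧
      IsChainOn (↑Γ.faces) k (bdry c - z) ∧ vsupp c = vsupp z

/-- The union of two simplicial complexes (taken facewise). -/
def aunion (Δ Γ : ASC V) : ASC V where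
  faces := Δ.faces ∪ Γ.faces
  down_closed := by
    intro s t hs hts
    rcases Finset.mem_union.1 hs with h | h
    · exact Finset.mem_union.2 (Or.inl (Δ.down_closed h hts))
    · exact Finset.mem_union.2 (Or.inr (Γ.down_closed h hts))

/-- The intersection of two simplicial complexes (taken facewise). -/
def ainter (Δ Γ : ASC V) : ASC V where
  faces := Δ.faces ∩ Γ.faces
  down_closed := by
    intro s t hs hts
    rw [Finset.mem_inter] at hs ⊢
    exact ⟨Δ.down_closed hs.1 hts, Γ.down_closed hs.2 hts⟩

/-- The `k`-skeleton of `Δ`: all faces of dimension at most `k`. -/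
def skel (Δ : ASC V) (k : ℤ) : ASC V where
  faces := Δ.faces.filter fun s => (s.card : ℤ) ≤ k + 1
  down_closed := by
    intro s t hs hts
    simp only [mem_filter] at hs ⊢
    refine ⟨Δ.down_closed hs.1 hts, le_trans ?_ hs.2⟩
    exact_mod_cast Finset.card_le_card hts

section

variable {R : Type*} [CommRing R]

theorem esign_insert {v w : V} {t : Finset V} (hw : w ∉ t) :
    esign v (insert w t) = if w < v then -esign v t else esign v t := by
  unfold esign
  rw [filter_insert]
  split_ifs with h
  · rw [card_insert_of_notMem (by simp [hw]), pow_succ, mul_neg_one]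
  · rfl

theorem esign_mul_self (v : V) (t : Finset V) : esign v t * esign v t = 1 := by
  unfold esign
  rw [← mul_pow]
  simp

theorem esign_mul_esign_insert {v w : V} {t : Finset V} (hvw : v ≠ w) (hv : v ∉ t)
    (hw : w ∉ t) :
    esign w t * esign v (insert w t) = -(esign v t * esign w (insert v t)) := by
  rw [esign_insert hw, esign_insert hv]
  rcases lt_or_gt_of_ne hvw with h | h
  · rw [if_neg h.not_gt, if_pos h]; ring
  · rw [if_pos h, if_neg h.not_gt]; ring

theorem compl_insert_sum {M : Type*} [AddCommMonoid M] {v : V} {t : Finset V} (hv : v ∉ t)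
    (f : V → M) : ∑ w ∈ tᶜ, f w = f v + ∑ w ∈ (insert v t)ᶜ, f w := by
  rw [compl_insert, add_sum_erase _ _ (by simpa using hv)]

theorem vsupp_bdry_subset (c : Finset V → R) : vsupp (bdry c) ⊆ vsupp c := by
  rintro x ⟨s, hs, hx⟩
  obtain ⟨v, -, hv⟩ := exists_ne_zero_of_sum_ne_zero hs
  exact ⟨insert v s, fun h => hv (by rw [h, smul_zero]), mem_insert_of_mem hx⟩

theorem bdry_sub (c d : Finset V → R) : bdry (c - d) = bdry c - bdry d := by
  funext t
  simp [bdry, smul_sub]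

/-- The cone `v * z` of a chain `z` with apex `v`. -/
def coneChain (v : V) (z : Finset V → R) : Finset V → R :=
  fun s => if v ∈ s then esign v (s.erase v) • z (s.erase v) else 0

/-- The chain `a` in the decomposition `d = v * a + b`, where `a` and `b` are
supported on faces avoiding `v`. -/
def linkChain (v : V) (d : Finset V → R) : Finset V → R :=
  fun t => if v ∈ t then 0 else esign v t • d (insert v t)

theorem coneChain_insert {v : V} {t : Finset V} (hv : v ∉ t) (z : Finset V → R) :
    coneChain v z (insert v t) = esign v t • z t := by
  simp [coneChain, erase_insert hv]

theorem bdry_coneChain {v : V} {z : Finset V → R} (hz : bdry z = 0)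
    (hv : ∀ s, v ∈ s → z s = 0) : bdry (coneChain v z) = z := by
  funext t
  by_cases ht : v ∈ t
  · obtain ⟨u, hu, rfl⟩ : ∃ u, v ∉ u ∧ insert v u = t :=
      ⟨t.erase v, notMem_erase v t, insert_erase ht⟩
    have key : bdry (coneChain v z) (insert v u) = -(esign v u • bdry z u) := by
      unfold bdry
      rw [compl_insert_sum hu (fun w => esign w u • z (insert w u)),
        hv _ (mem_insert_self v u), smul_zero, zero_add, smul_sum, ← sum_neg_distrib]
      refine sum_congr rfl fun w hw => ?_
      obtain ⟨hwv, hwu⟩ : w ≠ v ∧ w ∉ u := by simpa using hw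
      rw [insert_comm, coneChain_insert (by simp [hwv.symm, hu]), smul_smul, smul_smul,
        ← neg_smul, mul_comm (esign v u), ← neg_neg (esign w _ * _), mul_comm (esign w _),
        mul_comm (esign w u)]
      congr 2
      have h₁ := esign_mul_esign_insert hwv.symm hu hwu
      have h₂ := esign_mul_self v u
      have h₃ := esign_mul_self w u
      rw [esign_insert hu, esign_insert hwu] at *
      split_ifs at * <;> grind
    rw [key, hz, hv _ ht]
    simp
  · unfold bdry
    rw [compl_insert_sum ht, coneChain_insert ht, smul_smul, esign_mul_self, one_smul,
      sum_eq_zero, add_zero]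
    intro w hw
    obtain ⟨hwv, -⟩ : w ≠ v ∧ w ∉ t := by simpa using hw
    rw [coneChain, if_neg (by simp [hwv.symm, ht]), smul_zero]

theorem bdry_linkChain_of_mem {v : V} {t : Finset V} (hv : v ∈ t) (d : Finset V → R) :
    bdry (linkChain v d) t = 0 :=
  sum_eq_zero fun w _ => by rw [linkChain, if_pos (mem_insert_of_mem hv), smul_zero]

theorem bdry_linkChain_of_notMem {v : V} {t : Finset V} (hv : v ∉ t) (d : Finset V → R) :
    bdry (linkChain v d) t = -(esign v t • bdry d (insert v t)) := by
  unfold bdry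
  rw [compl_insert_sum hv, linkChain, if_pos (mem_insert_self v t), smul_zero, zero_add,
    smul_sum, ← sum_neg_distrib]
  refine sum_congr rfl fun w hw => ?_
  obtain ⟨hwv, hwt⟩ : w ≠ v ∧ w ∉ t := by simpa using hw
  rw [linkChain, if_neg (by simp [hwv.symm, hv]), insert_comm w v, smul_smul, smul_smul,
    ← neg_smul, esign_mul_esign_insert hwv.symm hv hwt]

theorem vsupp_sub_coneChain_subset {v : V} {c z : Finset V → R} (hc : vsupp c = vsupp z) :
    vsupp (c - coneChain v z) ⊆ insert v (vsupp z) := by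
  rintro x ⟨s, hs, hx⟩
  by_cases hxv : x = v
  · exact Or.inl hxv
  refine Or.inr ?_
  by_cases hcs : c s = 0
  · refine ⟨s.erase v, fun h => hs ?_, mem_erase.2 ⟨hxv, hx⟩⟩
    simp [coneChain, hcs, h]
  · exact hc ▸ ⟨s, hcs, hx⟩

theorem mem_link_faces {Δ : ASC V} {F t : Finset V} :
    t ∈ (link Δ F).faces ↔ Disjoint F t ∧ F ∪ t ∈ Δ.faces := by
  simp [link]

theorem ResChordal.link_singleton {Δ : ASC V} {k : ℤ} (h₀ : ResChordal R Δ (k - 1))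
    (h₁ : ResChordal R Δ k) (v : V) : ResChordal R (link Δ {v}) (k - 1) := by
  intro z hz hbz
  have hface : ∀ s, z s ≠ 0 → v ∉ s ∧ insert v s ∈ Δ.faces ∧ (s.card : ℤ) = k := by
    intro s hs
    obtain ⟨hs₁, hs₂⟩ := hz s hs
    have := mem_link_faces.1 (mem_coe.1 hs₁)
    rw [disjoint_singleton_left, ← insert_eq] at this
    exact ⟨this.1, this.2, by omega⟩
  have hzv : ∀ s, v ∈ s → z s = 0 := fun s hs => by
    by_contra h
    exact (hface s h).1 hs
  obtain ⟨c, hc, hbc, hcs⟩ := h₀ z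
    (fun s hs => ⟨Δ.down_closed (hface s hs).2.1 (subset_insert v s), (hz s hs).2⟩) hbz
  have hcv : ∀ s, v ∈ s → c s = 0 := by
    intro s hs
    by_contra h
    obtain ⟨u, hu, hvu⟩ : v ∈ vsupp z := hcs ▸ ⟨s, h, hs⟩
    exact hu (hzv u hvu)
  have hchain : IsChainOn (↑Δ.faces) k (c - coneChain v z) := by
    intro s hs
    by_cases hcs : c s = 0
    · have hvs : v ∈ s := by
        by_contra h
        exact hs (by simp [coneChain, hcs, h])
      have hne : z (s.erase v) ≠ 0 := fun h => hs (by simp [coneChain, hcs, h])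
      obtain ⟨-, hf, hk⟩ := hface _ hne
      rw [insert_erase hvs] at hf
      refine ⟨hf, ?_⟩
      rw [← card_erase_add_one hvs]
      push_cast
      omega
    · obtain ⟨hf, hk⟩ := hc s hcs
      exact ⟨hf, by omega⟩
  obtain ⟨d, hd, hbd, hds⟩ := h₁ _ hchain
    (by rw [bdry_sub, hbc, bdry_coneChain hbz hzv, sub_self])
  have hb : bdry (linkChain v d) = z := by
    funext t
    by_cases ht : v ∈ t
    · rw [bdry_linkChain_of_mem ht, hzv t ht]
    · rw [bdry_linkChain_of_notMem ht, hbd, Pi.sub_apply, hcv _ (mem_insert_self v t),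
        coneChain_insert ht, zero_sub, smul_neg, neg_neg, smul_smul, esign_mul_self, one_smul]
  have hne : ∀ t, linkChain v d t ≠ 0 → v ∉ t ∧ d (insert v t) ≠ 0 := by
    intro t ht
    refine ⟨fun h => ht (if_pos h), fun h => ht ?_⟩
    simp [linkChain, h]
  refine ⟨linkChain v d, fun t ht => ?_, hb, subset_antisymm ?_ ?_⟩
  · obtain ⟨hvt, hdt⟩ := hne t ht
    obtain ⟨hf, hk⟩ := hd _ hdt
    rw [card_insert_of_notMem hvt] at hk
    push_cast at hk
    refine ⟨mem_coe.2 (mem_link_faces.2 ⟨disjoint_singleton_left.2 hvt, ?_⟩), by omega⟩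
    rwa [← insert_eq]
  · rintro x ⟨t, ht, hx⟩
    obtain ⟨hvt, hdt⟩ := hne t ht
    have hxd : x ∈ vsupp d := ⟨_, hdt, mem_insert_of_mem hx⟩
    rw [hds] at hxd
    exact (vsupp_sub_coneChain_subset hcs hxd).resolve_left fun h => hvt (h ▸ hx)
  · conv_lhs => rw [← hb]
    exact vsupp_bdry_subset _

theorem ASC.ext_faces {Δ Γ : ASC V} (h : Δ.faces = Γ.faces) : Δ = Γ := by
  cases Δ
  cases Γ
  congr

theorem link_empty (Δ : ASC V) : link Δ ∅ = Δ :=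
  ASC.ext_faces <| by
    ext t
    simp [mem_link_faces]

theorem link_link_singleton (Δ : ASC V) {v : V} {F : Finset V} (hv : v ∉ F) :
    link (link Δ {v}) F = link Δ (insert v F) :=
  ASC.ext_faces <| by
    ext t
    simp only [mem_link_faces, disjoint_singleton_left, mem_union, insert_eq, disjoint_union_left, union_assoc, hv]
    tauto

theorem resChordal_link (F : Finset V) (Δ : ASC V) (k : ℤ)
    (h : ∀ j : ℤ, k - F.card ≤ j → j ≤ k → ResChordal R Δ j) :
    ResChordal R (link Δ F) (k - F.card) := by
  induction F using Finset.induction_on generalizing Δ k with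
  | empty =>
    rw [link_empty]
    exact h _ le_rfl (by simp)
  | insert v F hv ih =>
    rw [card_insert_of_notMem hv] at h ⊢
    push_cast at h ⊢
    rw [← link_link_singleton Δ hv, add_comm, ← sub_sub]
    refine ih _ _ fun j hj₁ hj₂ => ?_
    have := ResChordal.link_singleton (k := j + 1) (h (j + 1 - 1) (by omega) (by omega))
      (h (j + 1) (by omega) (by omega)) v
    rwa [add_sub_cancel_right] at this

end

/-- **Links Lemma** (Lemma 4.3): if `F` is an `ℓ`-dimensional face of `Δ` and
`Δ` is resolution `j`-chordal over `R` for all `k - ℓ - 1 ≤ j ≤ k`, then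
`Lk_F Δ` is resolution `(k - ℓ - 1)`-chordal over `R`. -/
theorem links_lemma {V : Type*} [Fintype V] [LinearOrder V]
    (R : Type*) [CommRing R] (Δ : ASC V) (F : Finset V) (hF : F ∈ Δ.faces)
    (ℓ : ℕ) (hcard : F.card = ℓ + 1) (k : ℤ)
    (hchordal : ∀ j : ℤ, k - ℓ - 1 ≤ j → j ≤ k → ResChordal R Δ j) :
    ResChordal R (link Δ F) (k - ℓ - 1) := by
  have h := resChordal_link (R := R) F Δ k fun j hj₁ hj₂ => hchordal j (by
    rw [hcard] at hj₁
    push_cast at hj₁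
    omega) hj₂
  rwa [hcard, Nat.cast_add, Nat.cast_one, ← sub_sub] at h
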